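/- Let d be a positive odd squarefree integer, n ≥ 2 even, and p an odd prime with p ∣ d. Let R = ℤ[√-d]/(p) with σ the ring endomorphism induced by conjugation, and let M = diag(1,…,1,-2) of size n+1. Then the number N of matrices A ∈ M_{n+1}(R) with A·M·σ(A)ᵀ = M and det A = 1 satisfies, as rational numbers, N = p^{(n+1)²-1} · ∏_{i=1}^{n/2} (1 - p^{-2i}); in particular it coincides with the corresponding count for the form L = diag(1,…,1,-1). -/

import Mathlib

open Matrix

/-- The quotient ring `ℤ[√-d]/(m)`. -/
abbrev Rq (d m : ℤ) : Type := Zsqrtd (-d) ⧸ Ideal.span {(m : Zsqrtd (-d))}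

/-- Conjugation `a + b√-d ↦ a - b√-d` descends to the quotient `ℤ[√-d]/(m)`. -/
noncomputable def conjQ (d m : ℤ) : Rq d m →+* Rq d m :=
  Ideal.quotientMap (Ideal.span {(m : Zsqrtd (-d))}) (starRingEnd (Zsqrtd (-d)))
    (by
      rw [Ideal.span_singleton_le_iff_mem, Ideal.mem_comap, map_intCast]
      exact Ideal.mem_span_singleton_self _)

/-- The diagonal matrix `diag(1, …, 1, -2)` of size `n+1`. -/
def Mmat (R : Type*) [Ring R] (n : ℕ) : Matrix (Fin (n + 1)) (Fin (n + 1)) R :=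
  Matrix.diagonal fun i => if i = Fin.last n then -2 else 1

/-- The diagonal matrix `diag(1, …, 1, -1)` of size `n+1`. -/
def Lmat (R : Type*) [Ring R] (n : ℕ) : Matrix (Fin (n + 1)) (Fin (n + 1)) R :=
  Matrix.diagonal fun i => if i = Fin.last n then -1 else 1

section SphereCount

variable {F : Type*} [Field F] [Fintype F] [DecidableEq F]

/-- The number of solutions of `∑ i, D i * v i ^ 2 = t`. -/
noncomputable def sphereCount {m : ℕ} (D : Fin m → F) (t : F) : ℕ :=
  Nat.card {v : Fin m → F // ∑ i, D i * v i ^ 2 = t}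

theorem sum_comp_sq (hF : ringChar F ≠ 2) (g : F → ℤ) :
    ∑ x : F, g (x ^ 2) = ∑ u : F, (quadraticChar F u + 1) * g u := by
  rw [← Finset.sum_fiberwise Finset.univ (fun x : F => x ^ 2) (fun x => g (x ^ 2))]
  refine Finset.sum_congr rfl fun u _ => ?_
  rw [← quadraticChar_card_sqrts hF u, Set.toFinset_ofPred, Finset.sum_congr rfl
    (g := fun _ => g u) (fun x hx => by rw [(Finset.mem_filter.mp hx).2])]
  simp

theorem sum_quadraticChar_mul_sub (hF : ringChar F ≠ 2) (t : F) :
    ∑ u : F, quadraticChar F u * quadraticChar F (t - u) =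
      -quadraticChar F (-1) + if t = 0 then Fintype.card F * quadraticChar F (-1) else 0 := by
  split_ifs with ht
  · subst ht
    have h (u : F) : quadraticChar F u * quadraticChar F (0 - u) =
        quadraticChar F (-1) - if u = 0 then quadraticChar F (-1) else 0 := by
      split_ifs with hu
      · simp [hu]
      · rw [zero_sub, neg_eq_neg_one_mul u, map_mul, mul_left_comm, ← sq, quadraticChar_sq_one hu]
        ring
    simp only [h, Finset.sum_sub_distrib, Finset.sum_ite_eq', Finset.mem_univ, if_true,
      Finset.sum_const, Finset.card_univ, nsmul_eq_mul]
    ring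
  · have hJ := jacobiSum_nontrivial_inv (quadraticChar_ne_one hF)
    rw [(quadraticChar_isQuadratic F).inv, jacobiSum] at hJ
    rw [add_zero, ← hJ, ← Equiv.sum_comp (Equiv.mulLeft₀ t ht)]
    refine Finset.sum_congr rfl fun u _ => ?_
    rw [Equiv.mulLeft₀_apply, show t - t * u = t * (1 - u) by ring, map_mul, map_mul,
      mul_mul_mul_comm, ← sq, quadraticChar_sq_one ht, one_mul]

theorem sum_quadraticChar_sub_sq (hF : ringChar F ≠ 2) (t : F) :
    ∑ x : F, quadraticChar F (t - x ^ 2) =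
      -quadraticChar F (-1) + if t = 0 then Fintype.card F * quadraticChar F (-1) else 0 := by
  rw [sum_comp_sq hF (fun u => quadraticChar F (t - u)), ← sum_quadraticChar_mul_sub hF t]
  simp only [add_mul, one_mul, Finset.sum_add_distrib]
  rw [show ∑ x : F, quadraticChar F (t - x) = _ from
    (Equiv.subLeft t).sum_comp (quadraticChar F), quadraticChar_sum_zero hF, add_zero]

theorem sum_sum_comp_sub_sq_sub_sq (hF : ringChar F ≠ 2) (h : F → ℤ) (t : F) :
    ∑ x : F, ∑ y : F, h (t - x ^ 2 - y ^ 2) =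
      (Fintype.card F - quadraticChar F (-1)) * ∑ u : F, h u +
        Fintype.card F * quadraticChar F (-1) * h t := by
  have h1 (x : F) : ∑ y : F, h (t - x ^ 2 - y ^ 2) =
      ∑ u : F, (quadraticChar F (u - x ^ 2) + 1) * h (t - u) := by
    rw [sum_comp_sq hF (fun w => h (t - x ^ 2 - w)), ← (Equiv.subRight (x ^ 2)).sum_comp]
    refine Finset.sum_congr rfl fun u _ => ?_
    rw [Equiv.subRight_apply, sub_sub, add_sub_cancel]
  have h2 (u : F) : ∑ x : F, (quadraticChar F (u - x ^ 2) + 1) * h (t - u) =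
      (Fintype.card F - quadraticChar F (-1)) * h (t - u) +
        if u = 0 then Fintype.card F * quadraticChar F (-1) * h t else 0 := by
    rw [← Finset.sum_mul, Finset.sum_add_distrib, sum_quadraticChar_sub_sq hF]
    split_ifs with hu
    · simp [hu]
      ring
    · simp
      left
      ring
  rw [Finset.sum_congr rfl fun x _ => h1 x, Finset.sum_comm, Finset.sum_congr rfl fun u _ => h2 u,
    Finset.sum_add_distrib, ← Finset.mul_sum,
    show ∑ u : F, h (t - u) = _ from (Equiv.subLeft t).sum_comp h]
  simp

theorem sum_sphereCount {m : ℕ} (D : Fin m → F) :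
    ∑ t : F, sphereCount D t = Fintype.card F ^ m := by
  have := Nat.card_congr (Equiv.sigmaFiberEquiv fun v : Fin m → F => ∑ i, D i * v i ^ 2)
  rw [Nat.card_sigma] at this
  simpa [sphereCount] using this

omit [DecidableEq F] in
theorem sphereCount_succ {m : ℕ} (D : Fin (m + 1) → F) (t : F) :
    sphereCount D t = ∑ x : F, sphereCount (fun i => D i.succ) (t - D 0 * x ^ 2) := by
  have e : {v : Fin (m + 1) → F // ∑ i, D i * v i ^ 2 = t} ≃
      Σ x : F, {w : Fin m → F // ∑ i, D i.succ * w i ^ 2 = t - D 0 * x ^ 2} :=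
    { toFun := fun v => ⟨v.1 0, fun i => v.1 i.succ, by
        rw [eq_sub_iff_add_eq', ← Fin.sum_univ_succ (fun i => D i * v.1 i ^ 2), v.2]⟩
      invFun := fun w => ⟨Fin.cons w.1 w.2.1, by
        rw [Fin.sum_univ_succ]
        simp [w.2.2]⟩
      left_inv := fun v => Subtype.ext (Fin.cons_self_tail v.1)
      right_inv := fun w => rfl }
  rw [sphereCount, Nat.card_congr e, Nat.card_sigma]
  rfl

/-- The coefficients of the form `x₀² + ⋯ + x_{j-1}² + c x_j²`. -/
def lastCoeff {R : Type*} [One R] (c : R) (j : ℕ) (i : Fin (j + 1)) : R :=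
  if i = Fin.last j then c else 1

theorem lastCoeff_zero {R : Type*} [One R] (c : R) (i : Fin 1) : lastCoeff c 0 i = c := by
  simp [lastCoeff, Subsingleton.elim i (Fin.last 0)]

theorem lastCoeff_succ_zero {R : Type*} [One R] (c : R) (j : ℕ) : lastCoeff c (j + 1) 0 = 1 := by
  rw [lastCoeff, if_neg (Fin.last_pos).ne]

theorem lastCoeff_succ_succ {R : Type*} [One R] (c : R) (j : ℕ) :
    (fun i => lastCoeff c (j + 1) (Fin.succ i)) = lastCoeff c j := by
  funext i
  simp only [lastCoeff, ← Fin.succ_last, Fin.succ_inj]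

omit [DecidableEq F] in
theorem sphereCount_lastCoeff_succ (c : F) (j : ℕ) (t : F) :
    sphereCount (lastCoeff c (j + 1)) t = ∑ x : F, sphereCount (lastCoeff c j) (t - x ^ 2) := by
  rw [sphereCount_succ, lastCoeff_succ_zero, lastCoeff_succ_succ]
  simp

theorem sphereCount_lastCoeff_zero (hF : ringChar F ≠ 2) {c : F} (hc : c ≠ 0) (t : F) :
    (sphereCount (lastCoeff c 0) t : ℤ) = 1 + quadraticChar F c * quadraticChar F t := by
  have e : {v : Fin 1 → F // ∑ i, lastCoeff c 0 i * v i ^ 2 = t} ≃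
      {x : F // x ^ 2 = c⁻¹ * t} :=
    (Equiv.funUnique (Fin 1) F).subtypeEquiv fun v => by
      rw [Fin.sum_univ_one, lastCoeff_zero, eq_inv_mul_iff_mul_eq₀ hc]
      rfl
  have h := quadraticChar_card_sqrts hF (c⁻¹ * t)
  have hinv : quadraticChar F c⁻¹ = quadraticChar F c := by
    have h1 : quadraticChar F c⁻¹ * quadraticChar F c = 1 := by
      rw [← map_mul, inv_mul_cancel₀ hc, map_one]
    rcases quadraticChar_dichotomy hc with h2 | h2 <;> rw [h2] at h1 ⊢ <;> linarith
  rw [map_mul, hinv] at h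
  rw [sphereCount, Nat.card_congr e, add_comm, ← h, Set.toFinset_card, ← Nat.card_eq_fintype_card]
  rfl

theorem sphereCount_lastCoeff_add_two (hF : ringChar F ≠ 2) (c : F) (j : ℕ) (t : F) :
    (sphereCount (lastCoeff c (j + 2)) t : ℤ) =
      (Fintype.card F - quadraticChar F (-1)) * (Fintype.card F : ℤ) ^ (j + 1) +
        Fintype.card F * quadraticChar F (-1) * sphereCount (lastCoeff c j) t := by
  rw [sphereCount_lastCoeff_succ, Finset.sum_congr rfl fun x _ => sphereCount_lastCoeff_succ c j _]
  push_cast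
  rw [sum_sum_comp_sub_sq_sub_sq hF (fun u => (sphereCount (lastCoeff c j) u : ℤ)),
    ← Nat.cast_sum, sum_sphereCount]
  push_cast
  rfl

theorem sphereCount_lastCoeff_even (hF : ringChar F ≠ 2) {c : F} (hc : c ≠ 0) (r : ℕ) :
    (sphereCount (lastCoeff c (2 * r)) 1 : ℤ) = (Fintype.card F : ℤ) ^ (2 * r) +
      (Fintype.card F : ℤ) ^ r * (quadraticChar F c * quadraticChar F (-1) ^ r) := by
  induction r with
  | zero => simp [sphereCount_lastCoeff_zero hF hc]
  | succ r ih =>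
    rw [mul_add, mul_one, sphereCount_lastCoeff_add_two hF, ih]
    ring

theorem sphereCount_lastCoeff_odd (hF : ringChar F ≠ 2) {c : F} (hc : c ≠ 0) (r : ℕ) :
    (sphereCount (lastCoeff c (2 * r + 1)) 1 : ℤ) = (Fintype.card F : ℤ) ^ (2 * r + 1) -
      (Fintype.card F : ℤ) ^ r * (quadraticChar F c * quadraticChar F (-1) ^ (r + 1)) := by
  induction r with
  | zero =>
    rw [mul_zero, zero_add, sphereCount_lastCoeff_succ]
    push_cast
    simp_rw [sphereCount_lastCoeff_zero hF hc, Finset.sum_add_distrib, ← Finset.mul_sum]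
    rw [sum_quadraticChar_sub_sq hF]
    simp
    ring
  | succ r ih =>
    have h := sphereCount_lastCoeff_add_two hF c (2 * r + 1) 1
    rw [ih] at h
    exact h.trans (by ring)

theorem sphereCount_lastCoeff_mul (hF : ringChar F ≠ 2) {c : F} (hc : c ≠ 0) (r : ℕ) :
    (sphereCount (lastCoeff c (2 * r + 2)) 1 * sphereCount (lastCoeff c (2 * r + 1)) 1 : ℤ) =
      (Fintype.card F : ℤ) ^ (2 * r + 1) * ((Fintype.card F : ℤ) ^ (2 * r + 2) - 1) := by
  have h1 := sphereCount_lastCoeff_even hF hc (r + 1)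
  rw [mul_add, mul_one] at h1
  rw [h1, sphereCount_lastCoeff_odd hF hc]
  have hs : (quadraticChar F c * quadraticChar F (-1) ^ (r + 1)) ^ 2 = 1 := by
    rw [mul_pow, ← pow_mul, mul_comm (r + 1), pow_mul, quadraticChar_sq_one hc,
      quadraticChar_sq_one (neg_ne_zero.mpr one_ne_zero), one_pow, one_mul]
  linear_combination (-(Fintype.card F : ℤ) ^ (2 * r + 1)) * hs

end SphereCount

section Orthogonal

variable {F : Type*} [Field F]

/-- The matrices preserving the diagonal form with coefficients `D`. -/
def IsOrth {ι R : Type*} [Fintype ι] [DecidableEq ι] [CommRing R] (D : ι → R)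
    (A : Matrix ι ι R) : Prop :=
  A * diagonal D * Aᵀ = diagonal D

section General

variable {ι : Type*} [Fintype ι] [DecidableEq ι] {D : ι → F}

theorem isOrth_iff (A : Matrix ι ι F) :
    IsOrth D A ↔ ∀ i j, ∑ k, A i k * D k * A j k = if i = j then D i else 0 := by
  rw [IsOrth, ← Matrix.ext_iff]
  simp only [Matrix.mul_apply (M := A * diagonal D), Matrix.mul_diagonal, Matrix.transpose_apply,
    Matrix.diagonal_apply]

theorem IsOrth.mul {A B : Matrix ι ι F} (hA : IsOrth D A) (hB : IsOrth D B) :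
    IsOrth D (A * B) := by
  unfold IsOrth at *
  calc A * B * diagonal D * (A * B)ᵀ = A * (B * diagonal D * Bᵀ) * Aᵀ := by
        simp only [Matrix.transpose_mul, Matrix.mul_assoc]
    _ = _ := by rw [hB, hA]

theorem IsOrth.neg {A : Matrix ι ι F} (hA : IsOrth D A) : IsOrth D (-A) := by
  simpa [IsOrth] using hA

theorem IsOrth.det_mul_self (hD : ∀ i, D i ≠ 0) {A : Matrix ι ι F} (hA : IsOrth D A) :
    A.det * A.det = 1 := by
  have h := congrArg Matrix.det hA
  rw [det_mul, det_mul, det_transpose, mul_right_comm] at h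
  refine mul_right_cancel₀ ?_ (h.trans (one_mul _).symm)
  rw [det_diagonal]
  exact Finset.prod_ne_zero_iff.mpr fun i _ => hD i

theorem IsOrth.isUnit_det (hD : ∀ i, D i ≠ 0) {A : Matrix ι ι F} (hA : IsOrth D A) :
    IsUnit A.det :=
  IsUnit.of_mul_eq_one _ (hA.det_mul_self hD)

theorem IsOrth.inv (hD : ∀ i, D i ≠ 0) {A : Matrix ι ι F} (hA : IsOrth D A) : IsOrth D A⁻¹ := by
  have hu := hA.isUnit_det hD
  unfold IsOrth at *
  calc A⁻¹ * diagonal D * A⁻¹ᵀ = A⁻¹ * (A * diagonal D * Aᵀ) * A⁻¹ᵀ := by rw [hA]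
    _ = (A⁻¹ * A) * diagonal D * (A⁻¹ * A)ᵀ := by
        simp only [Matrix.transpose_mul, Matrix.mul_assoc]
    _ = diagonal D := by rw [Matrix.nonsing_inv_mul _ hu]; simp

/-- The reflection in the hyperplane orthogonal to `u`, acting on row vectors. -/
def reflMatrix (D u : ι → F) : Matrix ι ι F :=
  1 - (2 / ∑ k, D k * u k ^ 2) • vecMulVec (D * u) u

theorem isOrth_reflMatrix {u : ι → F} (hu : ∑ k, D k * u k ^ 2 ≠ 0) :
    IsOrth D (reflMatrix D u) := by
  set a := ∑ k, D k * u k ^ 2 with ha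
  have h1 : diagonal D * (vecMulVec (D * u) u)ᵀ = vecMulVec (D * u) (D * u) := by
    ext i j
    simp [vecMulVec_apply, Matrix.diagonal_mul]
    ring
  have h2 : vecMulVec (D * u) u * diagonal D = vecMulVec (D * u) (D * u) := by
    ext i j
    simp [vecMulVec_apply, Matrix.mul_diagonal]
    ring
  have h3 : vecMulVec (D * u) (D * u) * (vecMulVec (D * u) u)ᵀ = a • vecMulVec (D * u) (D * u) := by
    ext i j
    simp only [Matrix.mul_apply, vecMulVec_apply, transpose_apply, Matrix.smul_apply, ha,
      Finset.sum_mul, smul_eq_mul, Pi.mul_apply]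
    exact Finset.sum_congr rfl fun k _ => by ring
  unfold IsOrth reflMatrix
  rw [← ha, Matrix.sub_mul, Matrix.one_mul, Matrix.smul_mul, h2, transpose_sub, transpose_one,
    transpose_smul, Matrix.mul_sub, Matrix.mul_one, Matrix.mul_smul, Matrix.sub_mul, h1,
    Matrix.smul_mul, h3, smul_sub, smul_smul, smul_smul]
  have h4 : 2 / a * (2 / a) * a = 2 / a + 2 / a := by field_simp; ring
  rw [h4, add_smul]
  abel

/-- Two vectors of the same nonzero norm, one being a basis vector, are related by an isometry. -/
theorem exists_isOrth_row_eq (h2 : (2 : F) ≠ 0) (i : ι) (hi : D i ≠ 0) {v : ι → F}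
    (hv : ∑ k, D k * v k ^ 2 = D i) : ∃ A, IsOrth D A ∧ A i = v := by
  have key (s : F) (hs : s * s = 1) : ∑ k, D k * (Pi.single i 1 - s • v : ι → F) k ^ 2 =
      2 * (D i * (1 - s * v i)) := by
    have h (k : ι) : D k * (Pi.single i 1 - s • v : ι → F) k ^ 2 =
        D k * v k ^ 2 + if k = i then D i * (1 - 2 * s * v i) else 0 := by
      by_cases hk : k = i
      · subst hk
        simp
        linear_combination D k * v k ^ 2 * hs
      · rw [Pi.sub_apply, Pi.single_eq_of_ne hk, if_neg hk, Pi.smul_apply, smul_eq_mul]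
        linear_combination D k * v k ^ 2 * hs
    rw [Finset.sum_congr rfl fun k _ => h k, Finset.sum_add_distrib, hv]
    simp
    ring
  have step (s : F) (hs : s * s = 1) (h : 1 - s * v i ≠ 0) :
      ∃ A, IsOrth D A ∧ A i = s • v := by
    have hne : ∑ k, D k * (Pi.single i 1 - s • v : ι → F) k ^ 2 ≠ 0 := by
      rw [key s hs]
      exact mul_ne_zero h2 (mul_ne_zero hi h)
    refine ⟨reflMatrix D (Pi.single i 1 - s • v), isOrth_reflMatrix hne, ?_⟩
    funext j
    rw [reflMatrix, key s hs]
    simp only [Matrix.sub_apply, Matrix.smul_apply, vecMulVec_apply, Pi.mul_apply, Pi.sub_apply,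
      Pi.smul_apply, smul_eq_mul, Pi.single_eq_same, Matrix.one_apply, Pi.single_apply, eq_comm]
    field_simp
    ring
  by_cases h : 1 - 1 * v i = 0
  · obtain ⟨A, hA, hAi⟩ := step (-1) (by ring) (fun h' => h2 (by linear_combination h + h'))
    exact ⟨-A, hA.neg, by
      funext j
      simp [hAi]⟩
  · simpa using step 1 (by ring) h

end General

theorem isOrth_reindex {m : ℕ} {D : Fin (m + 1) → F} {A : Matrix (Fin (m + 1)) (Fin (m + 1)) F}
    (h0 : ∀ j : Fin m, A 0 j.succ = 0) (h0' : ∀ j : Fin m, A j.succ 0 = 0) (h1 : A 0 0 = 1) :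
    IsOrth D A ↔ IsOrth (fun i => D i.succ) (A.submatrix Fin.succ Fin.succ) := by
  rw [isOrth_iff, isOrth_iff]
  simp [Fin.forall_fin_succ, Fin.sum_univ_succ, h0, h0', h1, Fin.succ_ne_zero,
    (Fin.succ_ne_zero _).symm]

theorem IsOrth.succ_zero_eq_zero {m : ℕ} {D : Fin (m + 1) → F} (hD : D 0 ≠ 0)
    {A : Matrix (Fin (m + 1)) (Fin (m + 1)) F} (hA : IsOrth D A) (h : A 0 = Pi.single 0 1)
    (j : Fin m) : A j.succ 0 = 0 := by
  have h' := (isOrth_iff A).mp hA j.succ 0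
  rw [h, if_neg (Fin.succ_ne_zero j)] at h'
  simpa [Pi.single_apply, hD] using h'

/-- The isometries fixing the first basis vector are the isometries of the remaining form. -/
def isOrthFixEquiv {m : ℕ} {D : Fin (m + 1) → F} (hD : D 0 ≠ 0) :
    {A : Matrix (Fin (m + 1)) (Fin (m + 1)) F // IsOrth D A ∧ A 0 = Pi.single 0 1} ≃
      {B : Matrix (Fin m) (Fin m) F // IsOrth (fun i => D i.succ) B} where
  toFun A := ⟨A.1.submatrix Fin.succ Fin.succ, (isOrth_reindex (by simp [A.2.2])
    (A.2.1.succ_zero_eq_zero hD A.2.2) (by simp [A.2.2])).mp A.2.1⟩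
  invFun B := ⟨Matrix.of (Fin.cons (Pi.single 0 1) fun i => Fin.cons 0 (B.1 i)),
    (isOrth_reindex (by simp) (by simp) (by simp)).mpr B.2, rfl⟩
  left_inv A := by
    ext i j
    refine Fin.cases ?_ (fun i => ?_) i
    · simp [A.2.2]
    · refine Fin.cases ?_ (fun j => ?_) j
      · simp [A.2.1.succ_zero_eq_zero hD A.2.2]
      · simp
  right_inv B := rfl

/-- The isometries with a given `i`-th row are a coset of those fixing the `i`-th basis vector. -/
noncomputable def isOrthRowEquiv {ι : Type*} [Fintype ι] [DecidableEq ι] {D : ι → F}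
    (hD : ∀ i, D i ≠ 0) {i : ι}
    {g : Matrix ι ι F} (hg : IsOrth D g) :
    {A : Matrix ι ι F // IsOrth D A ∧ A i = g i} ≃
      {A : Matrix ι ι F // IsOrth D A ∧ A i = Pi.single i 1} where
  toFun A := ⟨A.1 * g⁻¹, A.2.1.mul (hg.inv hD), by
    rw [Matrix.mul_apply_eq_vecMul, A.2.2, ← Matrix.mul_apply_eq_vecMul,
      Matrix.mul_nonsing_inv _ (hg.isUnit_det hD)]
    funext j
    simp [Matrix.one_apply, Pi.single_apply, eq_comm]⟩
  invFun A := ⟨A.1 * g, A.2.1.mul hg, by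
    rw [Matrix.mul_apply_eq_vecMul, A.2.2, Matrix.single_one_vecMul]
    rfl⟩
  left_inv A := Subtype.ext (by
    simp [Matrix.mul_assoc, Matrix.nonsing_inv_mul _ (hg.isUnit_det hD)])
  right_inv A := Subtype.ext (by
    simp [Matrix.mul_assoc, Matrix.mul_nonsing_inv _ (hg.isUnit_det hD)])

variable [Fintype F]

theorem card_isOrth_succ (h2 : (2 : F) ≠ 0) {m : ℕ} {D : Fin (m + 1) → F} (hD : ∀ i, D i ≠ 0) :
    Nat.card {A : Matrix (Fin (m + 1)) (Fin (m + 1)) F // IsOrth D A} =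
      sphereCount D (D 0) *
        Nat.card {B : Matrix (Fin m) (Fin m) F // IsOrth (fun i => D i.succ) B} := by
  classical
  let row (A : {A : Matrix (Fin (m + 1)) (Fin (m + 1)) F // IsOrth D A}) :
      {v : Fin (m + 1) → F // ∑ i, D i * v i ^ 2 = D 0} :=
    ⟨A.1 0, by
      rw [← (by simpa using (isOrth_iff A.1).mp A.2 0 0 : ∑ k, A.1 0 k * D k * A.1 0 k = D 0)]
      exact Finset.sum_congr rfl fun k _ => by ring⟩
  have hfib (v : {v : Fin (m + 1) → F // ∑ i, D i * v i ^ 2 = D 0}) :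
      Nat.card {A // row A = v} =
        Nat.card {B : Matrix (Fin m) (Fin m) F // IsOrth (fun i => D i.succ) B} := by
    obtain ⟨g, hg, hgv⟩ := exists_isOrth_row_eq h2 0 (hD 0) v.2
    refine Nat.card_congr (Equiv.trans ?_ ((isOrthRowEquiv hD hg).trans (isOrthFixEquiv (hD 0))))
    refine (Equiv.subtypeEquivRight fun A => ?_).trans
      (Equiv.subtypeSubtypeEquivSubtypeInter (IsOrth D) fun A => A 0 = g 0)
    rw [hgv, Subtype.ext_iff]
  rw [Nat.card_congr (Equiv.sigmaFiberEquiv row).symm, Nat.card_sigma,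
    Finset.sum_congr rfl fun v _ => hfib v, Finset.sum_const, smul_eq_mul, Finset.card_univ,
    ← Nat.card_eq_fintype_card]
  rfl

theorem card_isOrth_lastCoeff [DecidableEq F] (hF : ringChar F ≠ 2) {c : F} (hc : c ≠ 0) (k : ℕ) :
    (Nat.card {A : Matrix (Fin (2 * k + 1)) (Fin (2 * k + 1)) F //
        IsOrth (lastCoeff c (2 * k)) A} : ℤ) =
      2 * ∏ r ∈ Finset.range k,
        ((Fintype.card F : ℤ) ^ (2 * r + 1) * ((Fintype.card F : ℤ) ^ (2 * r + 2) - 1)) := by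
  have h2 : (2 : F) ≠ 0 := Ring.two_ne_zero hF
  have hne (j : ℕ) (i : Fin (j + 1)) : lastCoeff c j i ≠ 0 := by
    unfold lastCoeff
    split_ifs
    exacts [hc, one_ne_zero]
  have hstep (j : ℕ) : Nat.card {A : Matrix (Fin (j + 2)) (Fin (j + 2)) F //
        IsOrth (lastCoeff c (j + 1)) A} = sphereCount (lastCoeff c (j + 1)) 1 *
      Nat.card {A : Matrix (Fin (j + 1)) (Fin (j + 1)) F // IsOrth (lastCoeff c j) A} := by
    rw [card_isOrth_succ h2 (hne (j + 1)), lastCoeff_succ_succ, lastCoeff_succ_zero]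
  induction k with
  | zero =>
    have h := sphereCount_lastCoeff_zero hF hc c
    rw [← sq, quadraticChar_sq_one hc] at h
    have h1 : Nat.card {B : Matrix (Fin 0) (Fin 0) F //
        IsOrth (fun i => lastCoeff c 0 i.succ) B} = 1 :=
      Nat.card_eq_one_iff_unique.mpr ⟨inferInstance, ⟨1, Subsingleton.elim _ _⟩⟩
    rw [card_isOrth_succ h2 (hne (2 * 0)), h1, mul_one, lastCoeff_zero]
    exact h.trans (by simp)
  | succ k ih =>
    rw [Finset.prod_range_succ, ← sphereCount_lastCoeff_mul hF hc k, ← mul_assoc, ← ih]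
    have h := hstep (2 * k + 1)
    rw [hstep (2 * k)] at h
    rw [show 2 * (k + 1) = 2 * k + 1 + 1 from rfl, h]
    push_cast
    ring

/-- For forms of odd rank, half of the isometries have determinant one. -/
theorem card_isOrth_eq_two_mul [DecidableEq F] (h2 : (2 : F) ≠ 0) {ι : Type*} [Fintype ι]
    [DecidableEq ι] (hι : Odd (Fintype.card ι)) {D : ι → F} (hD : ∀ i, D i ≠ 0) :
    Nat.card {A : Matrix ι ι F // IsOrth D A} =
      2 * Nat.card {A : Matrix ι ι F // IsOrth D A ∧ A.det = 1} := by
  have hneg (A : Matrix ι ι F) : (-A).det = -A.det := by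
    rw [Matrix.det_neg, hι.neg_one_pow, neg_one_mul]
  have e : {A : {A : Matrix ι ι F // IsOrth D A} // ¬A.1.det = 1} ≃
      {A : {A : Matrix ι ι F // IsOrth D A} // A.1.det = 1} :=
    ((Equiv.neg (Matrix ι ι F)).subtypeEquiv fun A =>
      ⟨fun h => h.neg, fun h => by simpa using h.neg⟩).subtypeEquiv fun A => by
        change _ ↔ (-A.1).det = 1
        rw [hneg]
        rcases mul_self_eq_one_iff.mp (A.2.det_mul_self hD) with h | h
        · rw [h]
          refine iff_of_false (by simp) fun h' => h2 (by linear_combination -h')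
        · rw [h]
          refine iff_of_true (fun h' => h2 (by linear_combination -h')) (by simp)
  rw [← Nat.card_congr (Equiv.sumCompl fun A : {A : Matrix ι ι F // IsOrth D A} => A.1.det = 1),
    Nat.card_sum, Nat.card_congr e, ← two_mul, Nat.card_congr
    (Equiv.subtypeSubtypeEquivSubtypeInter (IsOrth D) fun A => A.det = 1)]

end Orthogonal

section TraceZero

variable {F ι : Type*} [Field F] [Fintype ι] [DecidableEq ι]

omit [Field F] [DecidableEq ι] in
theorem card_isSymm [Finite F] :
    Nat.card {X : Matrix ι ι F // X.IsSymm} =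
      Nat.card F ^ (Fintype.card ι + 1).choose 2 := by
  classical
  have e : {X : Matrix ι ι F // X.IsSymm} ≃ (Sym2 ι → F) :=
    (Equiv.subtypeEquivRight fun X => by
      rw [Matrix.IsSymm, ← Matrix.ext_iff, forall_comm]
      simp [Matrix.transpose_apply]).trans Sym2.lift
  rw [Nat.card_congr e, Nat.card_fun, Nat.card_eq_fintype_card (α := Sym2 ι), Sym2.card]

/-- Symmetric matrices on which a nonzero weighted trace vanishes form a hyperplane. -/
theorem card_isSymm_eq_mul [Nonempty ι] {w : ι → F} (hw : ∀ i, w i ≠ 0) :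
    Nat.card {X : Matrix ι ι F // X.IsSymm} =
      Nat.card F * Nat.card {X : Matrix ι ι F // X.IsSymm ∧ ∑ i, X i i * w i = 0} := by
  obtain ⟨o⟩ := ‹Nonempty ι›
  have hs (t : F) : ∑ i, single o o t i i * w i = t * w o := by
    simp [Matrix.single_apply]
  have hsymm (t : F) : (single o o t).IsSymm := by simp [Matrix.IsSymm]
  have e : {X : Matrix ι ι F // X.IsSymm} ≃
      F × {X : Matrix ι ι F // X.IsSymm ∧ ∑ i, X i i * w i = 0} :=
    { toFun := fun X => ⟨∑ i, X.1 i i * w i,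
        X.1 - single o o ((∑ i, X.1 i i * w i) / w o), X.2.sub (hsymm _), by
          simp only [Matrix.sub_apply, sub_mul, Finset.sum_sub_distrib, hs]
          rw [div_mul_cancel₀ _ (hw o), sub_self]⟩
      invFun := fun Y => ⟨Y.2.1 + single o o (Y.1 / w o), Y.2.2.1.add (hsymm _)⟩
      left_inv := fun X => Subtype.ext (sub_add_cancel _ _)
      right_inv := fun Y => by
        have h : ∑ i, (Y.2.1 + single o o (Y.1 / w o)) i i * w i = Y.1 := by
          simp only [Matrix.add_apply, add_mul, Finset.sum_add_distrib, hs]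
          rw [Y.2.2.2, div_mul_cancel₀ _ (hw o), zero_add]
        refine Prod.ext h (Subtype.ext ?_)
        simp only [h]
        exact add_sub_cancel_right _ _ }
  rw [Nat.card_congr e, Nat.card_prod]

end TraceZero

section DualNumber

open scoped DualNumber

variable {F ι : Type*} [Field F] [Fintype ι] [DecidableEq ι]

/-- The conjugation `a + b ε ↦ a - b ε`. -/
def DualNumber.conj (F : Type*) [Field F] : F[ε] →+* F[ε] :=
  (TrivSqZeroExt.map (-LinearMap.id : F →ₗ[F] F)).toRingHom

theorem DualNumber.fst_conj (x : F[ε]) : (DualNumber.conj F x).fst = x.fst :=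
  TrivSqZeroExt.fst_map _ x

theorem DualNumber.snd_conj (x : F[ε]) : (DualNumber.conj F x).snd = -x.snd :=
  TrivSqZeroExt.snd_map _ x

/-- Matrices over the dual numbers are pairs of matrices. -/
def dualMatrixEquiv : Matrix ι ι F[ε] ≃ Matrix ι ι F × Matrix ι ι F where
  toFun A := (A.map TrivSqZeroExt.fst, A.map TrivSqZeroExt.snd)
  invFun P := Matrix.of fun i j => (P.1 i j, P.2 i j)
  left_inv _ := rfl
  right_inv _ := rfl

omit [Field F] [Fintype ι] [DecidableEq ι] in
theorem dualMatrix_ext_iff {A B : Matrix ι ι F[ε]} :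
    A = B ↔ A.map TrivSqZeroExt.fst = B.map TrivSqZeroExt.fst ∧
      A.map TrivSqZeroExt.snd = B.map TrivSqZeroExt.snd := by
  rw [← dualMatrixEquiv.injective.eq_iff, Prod.ext_iff]
  rfl

omit [DecidableEq ι] in
theorem map_fst_mul (A B : Matrix ι ι F[ε]) :
    (A * B).map TrivSqZeroExt.fst = A.map TrivSqZeroExt.fst * B.map TrivSqZeroExt.fst :=
  Matrix.map_mul (f := (TrivSqZeroExt.fstHom F F F).toRingHom)

omit [DecidableEq ι] in
theorem map_snd_mul (A B : Matrix ι ι F[ε]) :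
    (A * B).map TrivSqZeroExt.snd = A.map TrivSqZeroExt.fst * B.map TrivSqZeroExt.snd +
      A.map TrivSqZeroExt.snd * B.map TrivSqZeroExt.fst := by
  ext i j
  simp [Matrix.mul_apply, TrivSqZeroExt.snd_sum, Finset.sum_add_distrib, mul_comm]

theorem det_one_add_eps_smul (X : Matrix ι ι F) :
    ((1 : Matrix ι ι F[ε]) + (ε : F[ε]) • X.map (TrivSqZeroExt.inl : F → F[ε])).det =
      1 + TrivSqZeroExt.inr X.trace := by
  have h : (X.map (TrivSqZeroExt.inl : F → F[ε])).trace = TrivSqZeroExt.inl X.trace :=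
    (AddMonoidHom.map_trace (TrivSqZeroExt.inlHom F F).toAddMonoidHom X).symm
  rw [Matrix.det_one_add_smul, sq, DualNumber.eps_mul_eps, mul_zero, add_zero, h]
  ext <;> simp

theorem fst_det (A : Matrix ι ι F[ε]) : A.det.fst = (A.map TrivSqZeroExt.fst).det :=
  RingHom.map_det (TrivSqZeroExt.fstHom F F F).toRingHom A

theorem snd_det {A : Matrix ι ι F[ε]} (hA : IsUnit (A.map TrivSqZeroExt.fst).det) :
    A.det.snd = (A.map TrivSqZeroExt.fst).det *
      ((A.map TrivSqZeroExt.fst)⁻¹ * A.map TrivSqZeroExt.snd).trace := by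
  set A₀ := A.map TrivSqZeroExt.fst with hA₀
  set A₁ := A.map TrivSqZeroExt.snd with hA₁
  have h : A = A₀.map (TrivSqZeroExt.inl : F → F[ε]) *
      (1 + (ε : F[ε]) • (A₀⁻¹ * A₁).map (TrivSqZeroExt.inl : F → F[ε])) := by
    have h0 : ((1 : Matrix ι ι F[ε]) + (ε : F[ε]) •
        (A₀⁻¹ * A₁).map (TrivSqZeroExt.inl : F → F[ε])).map TrivSqZeroExt.fst = 1 := by
      ext i j
      by_cases hij : i = j <;> simp [Matrix.one_apply, hij]
    have h1 : ((1 : Matrix ι ι F[ε]) + (ε : F[ε]) •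
        (A₀⁻¹ * A₁).map (TrivSqZeroExt.inl : F → F[ε])).map TrivSqZeroExt.snd = A₀⁻¹ * A₁ := by
      ext i j
      by_cases hij : i = j <;> simp [hij]
    have h2 : (A₀.map (TrivSqZeroExt.inl : F → F[ε])).map TrivSqZeroExt.fst = A₀ := rfl
    have h3 : (A₀.map (TrivSqZeroExt.inl : F → F[ε])).map TrivSqZeroExt.snd = 0 := rfl
    rw [dualMatrix_ext_iff, map_fst_mul, map_snd_mul, h0, h1, h2, h3, ← Matrix.mul_assoc,
      Matrix.mul_nonsing_inv _ hA]
    simp [hA₀, hA₁]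
  have hdet : (A₀.map (TrivSqZeroExt.inl : F → F[ε])).det = TrivSqZeroExt.inl A₀.det :=
    (RingHom.map_det (TrivSqZeroExt.inlHom F F) A₀).symm
  rw [h, det_mul, det_one_add_eps_smul, hdet]
  simp

/-- The defining conditions of the special unitary group over the dual numbers. -/
def IsDualSU (D : ι → F) (A : Matrix ι ι F[ε]) : Prop :=
  A * (diagonal D).map TrivSqZeroExt.inl * (A.map (DualNumber.conj F))ᵀ =
      (diagonal D).map TrivSqZeroExt.inl ∧ A.det = 1

theorem IsOrth.mul_eq_one {D : ι → F} (hD : ∀ i, D i ≠ 0) {A : Matrix ι ι F} (hA : IsOrth D A) :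
    A * (diagonal D * Aᵀ * diagonal fun i => (D i)⁻¹) = 1 := by
  rw [← Matrix.mul_assoc, ← Matrix.mul_assoc, show A * diagonal D * Aᵀ = _ from hA,
    Matrix.diagonal_mul_diagonal]
  simp [hD]

theorem isDualSU_iff {D : ι → F} (hD : ∀ i, D i ≠ 0) (A : Matrix ι ι F[ε]) :
    IsDualSU D A ↔
      (IsOrth D (A.map TrivSqZeroExt.fst) ∧ (A.map TrivSqZeroExt.fst).det = 1) ∧
      (A.map TrivSqZeroExt.snd * diagonal D * (A.map TrivSqZeroExt.fst)ᵀ).IsSymm ∧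
      ∑ i, (A.map TrivSqZeroExt.snd * diagonal D * (A.map TrivSqZeroExt.fst)ᵀ) i i * (D i)⁻¹ =
        0 := by
  have hD0 : ((diagonal D).map (TrivSqZeroExt.inl : F → F[ε])).map TrivSqZeroExt.fst =
    diagonal D := rfl
  have hD1 : ((diagonal D).map (TrivSqZeroExt.inl : F → F[ε])).map TrivSqZeroExt.snd = 0 := rfl
  have hc0 : ((A.map (DualNumber.conj F))ᵀ).map TrivSqZeroExt.fst =
      (A.map TrivSqZeroExt.fst)ᵀ := by
    ext i j
    exact DualNumber.fst_conj _
  have hc1 : ((A.map (DualNumber.conj F))ᵀ).map TrivSqZeroExt.snd =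
      -(A.map TrivSqZeroExt.snd)ᵀ := by
    ext i j
    exact DualNumber.snd_conj _
  rw [IsDualSU, dualMatrix_ext_iff, map_fst_mul, map_snd_mul, map_fst_mul, map_snd_mul, hD0, hD1,
    hc0, hc1, Matrix.mul_zero, zero_add, TrivSqZeroExt.ext_iff, fst_det]
  set A₀ := A.map TrivSqZeroExt.fst with hA₀
  set A₁ := A.map TrivSqZeroExt.snd with hA₁
  have hsymm : A₀ * diagonal D * -A₁ᵀ + A₁ * diagonal D * A₀ᵀ = 0 ↔
      (A₁ * diagonal D * A₀ᵀ).IsSymm := by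
    rw [Matrix.IsSymm, Matrix.mul_neg, neg_add_eq_zero, Matrix.transpose_mul, Matrix.transpose_mul,
      Matrix.transpose_transpose, Matrix.diagonal_transpose, Matrix.mul_assoc]
  have htrace (h : IsOrth D A₀) (hdet : A₀.det = 1) :
      A.det.snd = ∑ i, (A₁ * diagonal D * A₀ᵀ) i i * (D i)⁻¹ := by
    rw [snd_det (by rw [← hA₀, hdet]; exact isUnit_one), ← hA₀, ← hA₁, hdet, one_mul,
      Matrix.inv_eq_right_inv (h.mul_eq_one hD), Matrix.trace_mul_comm, ← Matrix.mul_assoc,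
      ← Matrix.mul_assoc, Matrix.trace]
    simp only [Matrix.diag_apply, Matrix.mul_diagonal]
  rw [hsymm, TrivSqZeroExt.fst_one, TrivSqZeroExt.snd_one]
  constructor
  · rintro ⟨⟨h1, h2⟩, h3, h4⟩
    exact ⟨⟨h1, h3⟩, h2, by rw [← htrace h1 h3, h4]⟩
  · rintro ⟨⟨h1, h3⟩, h2, h4⟩
    exact ⟨⟨h1, h2⟩, h3, by rw [htrace h1 h3, h4]⟩

theorem card_isDualSU {D : ι → F} (hD : ∀ i, D i ≠ 0) :
    Nat.card {A // IsDualSU D A} = Nat.card {A : Matrix ι ι F // IsOrth D A ∧ A.det = 1} *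
      Nat.card {X : Matrix ι ι F // X.IsSymm ∧ ∑ i, X i i * (D i)⁻¹ = 0} := by
  have key {A₀ : Matrix ι ι F} (h : IsOrth D A₀) (X : Matrix ι ι F) :
      X * (diagonal fun i => (D i)⁻¹) * A₀ * diagonal D * A₀ᵀ = X := by
    calc _ = X * (diagonal fun i => (D i)⁻¹) * (A₀ * diagonal D * A₀ᵀ) := by
          simp only [Matrix.mul_assoc]
      _ = X := by
          rw [show A₀ * diagonal D * A₀ᵀ = _ from h, Matrix.mul_assoc,
            Matrix.diagonal_mul_diagonal]
          simp [hD]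
  rw [← Nat.card_prod]
  refine Nat.card_congr
    { toFun := fun A => ⟨⟨_, ((isDualSU_iff hD A.1).mp A.2).1⟩,
        ⟨_, ((isDualSU_iff hD A.1).mp A.2).2⟩⟩
      invFun := fun P => ⟨dualMatrixEquiv.symm
        (P.1.1, P.2.1 * (diagonal fun i => (D i)⁻¹) * P.1.1), (isDualSU_iff hD _).mpr ⟨P.1.2, by
          have h := P.2.2
          rw [← key P.1.2.1 P.2.1] at h
          exact h⟩⟩
      left_inv := fun A => ?_
      right_inv := fun P => Prod.ext rfl (Subtype.ext (key P.1.2.1 P.2.1)) }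
  have h := mul_eq_one_comm.mp (((isDualSU_iff hD A.1).mp A.2).1.1.mul_eq_one hD)
  refine Subtype.ext (dualMatrix_ext_iff.mpr ⟨rfl, ?_⟩)
  change A.1.map TrivSqZeroExt.snd * diagonal D * (A.1.map TrivSqZeroExt.fst)ᵀ *
    (diagonal fun i => (D i)⁻¹) * A.1.map TrivSqZeroExt.fst = _
  calc _ = A.1.map TrivSqZeroExt.snd * (diagonal D * (A.1.map TrivSqZeroExt.fst)ᵀ *
        (diagonal fun i => (D i)⁻¹) * A.1.map TrivSqZeroExt.fst) := by
        simp only [Matrix.mul_assoc]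
    _ = _ := by rw [h, Matrix.mul_one]

end DualNumber

section Quotient

open scoped DualNumber

/-- For `p ∣ d`, reduction `a + b√-d ↦ a + b ε` from `ℤ[√-d]` to the dual numbers over `𝔽_p`. -/
noncomputable def zsqrtdToDual (d : ℤ) (p : ℕ) [Fact p.Prime] (hpd : (p : ℤ) ∣ d) :
    Zsqrtd (-d) →+* (ZMod p)[ε] :=
  Zsqrtd.lift ⟨ε, by
    rw [DualNumber.eps_mul_eps, ← map_intCast (TrivSqZeroExt.inlHom (ZMod p) (ZMod p)),
      (ZMod.intCast_zmod_eq_zero_iff_dvd (-d) p).mpr (hpd.neg_right), map_zero]⟩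

variable {d : ℤ} {p : ℕ} [Fact p.Prime]

theorem fst_zsqrtdToDual (hpd : (p : ℤ) ∣ d) (x : Zsqrtd (-d)) :
    (zsqrtdToDual d p hpd x).fst = x.re := by
  simp [zsqrtdToDual]

theorem snd_zsqrtdToDual (hpd : (p : ℤ) ∣ d) (x : Zsqrtd (-d)) :
    (zsqrtdToDual d p hpd x).snd = x.im := by
  simp [zsqrtdToDual]

theorem zsqrtdToDual_surjective (hpd : (p : ℤ) ∣ d) :
    Function.Surjective (zsqrtdToDual d p hpd) := fun x => by
  obtain ⟨a, ha⟩ := ZMod.intCast_surjective x.fst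
  obtain ⟨b, hb⟩ := ZMod.intCast_surjective x.snd
  exact ⟨⟨a, b⟩, TrivSqZeroExt.ext ((fst_zsqrtdToDual hpd _).trans ha)
    ((snd_zsqrtdToDual hpd _).trans hb)⟩

theorem ker_zsqrtdToDual (hpd : (p : ℤ) ∣ d) :
    RingHom.ker (zsqrtdToDual d p hpd) = Ideal.span {(((p : ℤ) : ℤ) : Zsqrtd (-d))} := by
  ext x
  rw [RingHom.mem_ker, TrivSqZeroExt.ext_iff, fst_zsqrtdToDual, snd_zsqrtdToDual,
    Ideal.mem_span_singleton, Zsqrtd.intCast_dvd,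
    ← ZMod.intCast_zmod_eq_zero_iff_dvd, ← ZMod.intCast_zmod_eq_zero_iff_dvd]
  rfl

/-- For `p ∣ d`, the ring `ℤ[√-d]/(p)` is the ring of dual numbers over `𝔽_p`. -/
noncomputable def rqEquivDual (hpd : (p : ℤ) ∣ d) : Rq d p ≃+* (ZMod p)[ε] :=
  (Ideal.quotEquivOfEq (ker_zsqrtdToDual hpd).symm).trans
    (RingHom.quotientKerEquivOfSurjective (zsqrtdToDual_surjective hpd))

theorem rqEquivDual_mk (hpd : (p : ℤ) ∣ d) (x : Zsqrtd (-d)) :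
    rqEquivDual hpd (Ideal.Quotient.mk _ x) = zsqrtdToDual d p hpd x := rfl

theorem rqEquivDual_conjQ (hpd : (p : ℤ) ∣ d) (x : Rq d p) :
    rqEquivDual hpd (conjQ d p x) = DualNumber.conj (ZMod p) (rqEquivDual hpd x) := by
  obtain ⟨x, rfl⟩ := Ideal.Quotient.mk_surjective x
  rw [conjQ, Ideal.quotientMap_mk, rqEquivDual_mk, rqEquivDual_mk]
  refine TrivSqZeroExt.ext ?_ ?_
  · rw [DualNumber.fst_conj, fst_zsqrtdToDual, fst_zsqrtdToDual, starRingEnd_apply, Zsqrtd.re_star]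
  · rw [DualNumber.snd_conj, snd_zsqrtdToDual, snd_zsqrtdToDual, starRingEnd_apply, Zsqrtd.im_star,
      Int.cast_neg]

theorem card_SU_eq_card_isDualSU (hpd : (p : ℤ) ∣ d) (c : ℤ) (n : ℕ) :
    Nat.card {A : Matrix (Fin (n + 1)) (Fin (n + 1)) (Rq d p) //
        A * diagonal (lastCoeff (c : Rq d p) n) * (A.map (conjQ d p))ᵀ =
          diagonal (lastCoeff (c : Rq d p) n) ∧ A.det = 1} =
      Nat.card {A // IsDualSU (lastCoeff (c : ZMod p) n) A} := by
  set e := rqEquivDual hpd with he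
  have hM : (diagonal (lastCoeff (c : Rq d p) n)).map e =
      (diagonal (lastCoeff (c : ZMod p) n)).map (TrivSqZeroExt.inl : ZMod p → (ZMod p)[ε]) := by
    rw [Matrix.diagonal_map (map_zero e), Matrix.diagonal_map (TrivSqZeroExt.inl_zero _)]
    congr 1
    funext i
    simp only [lastCoeff]
    split_ifs
    · rw [map_intCast, TrivSqZeroExt.inl_intCast]
    · rw [map_one, TrivSqZeroExt.inl_one]
  refine Nat.card_congr (e.mapMatrix.toEquiv.subtypeEquiv fun A => ?_)
  have hconj : ((A.map e).map (DualNumber.conj (ZMod p)))ᵀ = (A.map (conjQ d p))ᵀ.map e := by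
    ext1 i j
    exact (rqEquivDual_conjQ hpd _).symm
  have hdet : (A.map e).det = e A.det := (RingEquiv.map_det e A).symm
  change _ ↔ IsDualSU _ (A.map e)
  rw [IsDualSU, hconj, hdet, ← hM, ← Matrix.map_mul, ← Matrix.map_mul,
    (Matrix.map_injective e.injective).eq_iff, map_eq_one_iff e e.injective]

end Quotient

theorem prod_range_eq_pow_mul_prod_Icc {q : ℚ} (hq : q ≠ 0) (k : ℕ) :
    ∏ r ∈ Finset.range k, (q ^ (2 * r + 1) * (q ^ (2 * r + 2) - 1)) =
      q ^ (2 * k ^ 2 + k) * ∏ i ∈ Finset.Icc 1 k, (1 - q ^ (-(2 * (i : ℤ)))) := by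
  induction k with
  | zero => simp
  | succ k ih =>
    have h : q ^ (-(2 * ((k + 1 : ℕ) : ℤ))) = (q ^ (2 * k + 2))⁻¹ := by
      rw [_root_.zpow_neg, ← zpow_natCast]
      push_cast
      ring_nf
    rw [Finset.prod_range_succ, Finset.prod_Icc_succ_top (by omega), ih, h]
    field_simp
    ring

theorem card_SU_mod_ramified {d : ℤ} {p : ℕ} (hp : p.Prime) (hp2 : p ≠ 2) (hpd : (p : ℤ) ∣ d)
    {c : ℤ} (hc : ¬(p : ℤ) ∣ c) (k : ℕ) :
    (Nat.card {A : Matrix (Fin (2 * k + 1)) (Fin (2 * k + 1)) (Rq d p) //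
        A * diagonal (lastCoeff (c : Rq d p) (2 * k)) * (A.map (conjQ d p))ᵀ =
          diagonal (lastCoeff (c : Rq d p) (2 * k)) ∧ A.det = 1} : ℚ) =
      (p : ℚ) ^ ((2 * k + 1) ^ 2 - 1) *
        ∏ i ∈ Finset.Icc 1 k, (1 - (p : ℚ) ^ (-(2 * (i : ℤ)))) := by
  have := Fact.mk hp
  have hF : ringChar (ZMod p) ≠ 2 := by rwa [ZMod.ringChar_zmod_n]
  have hc0 : (c : ZMod p) ≠ 0 := fun h => hc ((ZMod.intCast_zmod_eq_zero_iff_dvd c p).mp h)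
  have hD (i : Fin (2 * k + 1)) : lastCoeff (c : ZMod p) (2 * k) i ≠ 0 := by
    unfold lastCoeff
    split_ifs
    exacts [hc0, one_ne_zero]
  have hp0 : (p : ℚ) ≠ 0 := Nat.cast_ne_zero.mpr hp.ne_zero
  have hO := card_isOrth_lastCoeff hF hc0 k
  rw [card_isOrth_eq_two_mul (Ring.two_ne_zero hF) (by simp) hD, ZMod.card] at hO
  have hS := card_isSymm_eq_mul (F := ZMod p) fun i => inv_ne_zero (hD i)
  rw [card_isSymm, Fintype.card_fin, Nat.card_zmod, Nat.choose_two_right,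
    show (2 * k + 1 + 1) * (2 * k + 1 + 1 - 1) = 2 * ((2 * k ^ 2 + 3 * k) + 1) by
      rw [Nat.add_sub_cancel]; ring, Nat.mul_div_cancel_left _ two_pos, pow_succ'] at hS
  have hS' := Nat.eq_of_mul_eq_mul_left hp.pos hS
  have hO' : (Nat.card {A : Matrix (Fin (2 * k + 1)) (Fin (2 * k + 1)) (ZMod p) //
      IsOrth (lastCoeff (c : ZMod p) (2 * k)) A ∧ A.det = 1} : ℚ) =
      ∏ r ∈ Finset.range k, ((p : ℚ) ^ (2 * r + 1) * ((p : ℚ) ^ (2 * r + 2) - 1)) := by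
    rw [Nat.cast_mul, Nat.cast_two] at hO
    have h := mul_left_cancel₀ two_ne_zero hO
    exact_mod_cast congrArg (Int.cast : ℤ → ℚ) h
  rw [card_SU_eq_card_isDualSU hpd, card_isDualSU hD, ← hS', Nat.cast_mul, hO',
    prod_range_eq_pow_mul_prod_Icc hp0, Nat.cast_pow,
    show (2 * k + 1) ^ 2 - 1 = (2 * k ^ 2 + k) + (2 * k ^ 2 + 3 * k) by
      rw [show (2 * k + 1) ^ 2 = (2 * k ^ 2 + k) + (2 * k ^ 2 + 3 * k) + 1 by ring,
        Nat.add_sub_cancel], pow_add]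
  ring

/-- For `n` even and an odd ramified prime `p ∣ d`, the order of `SU(M, ℤ[√-d]/(p))`
equals `p^{(n+1)²-1} · ∏_{i=1}^{n/2} (1 - p^{-2i})`; in particular it coincides with
the corresponding count for `L = diag(1, …, 1, -1)`. -/
theorem card_SU_M_mod_p_ramified_even (d : ℤ) (hd : 0 < d) (hodd : Odd d)
    (hsf : Squarefree d) (n : ℕ) (hn : 2 ≤ n) (hneven : Even n)
    (p : ℕ) (hp : p.Prime) (hp2 : p ≠ 2) (hpd : (p : ℤ) ∣ d) :
    (Nat.card {A : Matrix (Fin (n + 1)) (Fin (n + 1)) (Rq d p) //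
        A * Mmat (Rq d p) n * (A.map (conjQ d p))ᵀ = Mmat (Rq d p) n ∧
        A.det = 1} : ℚ)
      = (p : ℚ) ^ ((n + 1) ^ 2 - 1) *
        ∏ i ∈ Finset.Icc 1 (n / 2), (1 - (p : ℚ) ^ (-(2 * (i : ℤ)))) ∧
    Nat.card {A : Matrix (Fin (n + 1)) (Fin (n + 1)) (Rq d p) //
        A * Mmat (Rq d p) n * (A.map (conjQ d p))ᵀ = Mmat (Rq d p) n ∧
        A.det = 1}
      = Nat.card {A : Matrix (Fin (n + 1)) (Fin (n + 1)) (Rq d p) //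
        A * Lmat (Rq d p) n * (A.map (conjQ d p))ᵀ = Lmat (Rq d p) n ∧
        A.det = 1} := by
  obtain ⟨k, rfl⟩ := hneven.two_dvd
  have hM : Mmat (Rq d p) (2 * k) = diagonal (lastCoeff ((-2 : ℤ) : Rq d p) (2 * k)) := by
    push_cast
    rfl
  have hL : Lmat (Rq d p) (2 * k) = diagonal (lastCoeff ((-1 : ℤ) : Rq d p) (2 * k)) := by
    push_cast
    rfl
  have h2 : ¬(p : ℤ) ∣ -2 := by
    rw [dvd_neg]
    exact_mod_cast fun h => hp2 ((Nat.prime_dvd_prime_iff_eq hp Nat.prime_two).mp h)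
  have h1 : ¬(p : ℤ) ∣ -1 := by
    rw [dvd_neg]
    exact_mod_cast hp.not_dvd_one
  rw [hM, hL, Nat.mul_div_cancel_left _ two_pos]
  refine ⟨card_SU_mod_ramified hp hp2 hpd h2 k, ?_⟩
  exact_mod_cast (card_SU_mod_ramified hp hp2 hpd h2 k).trans
    (card_SU_mod_ramified hp hp2 hpd h1 k).symm
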